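/- Consider the problem (VOP) with feasible set X := {x ∈ ℝⁿ : g_i(x) ≤ 0, i = 1, …, p} and C^{1,1} data. Let x̄ be a local weak efficient solution of (VOP), suppose the Abadie second-order constraint qualification holds at x̄ with respect to every critical direction at x̄, and let ū be a critical direction at x̄. Then there exist λ ∈ ℝᵐ with λ ≥ 0 componentwise and λ ≠ 0, and μ ∈ ℝᵖ with μ ≥ 0 componentwise, such that: (i) Σ_{l=1}^m λ_l ∇f_l(x̄) + Σ_{i=1}^p μ_i ∇g_i(x̄) = 0; (ii) Σ_{l=1}^m λ_l · max{⟨ξ, ū⟩ : ξ ∈ ∂²f_l(x̄)(ū)} + Σ_{i=1}^p μ_i · max{⟨ζ, ū⟩ : ζ ∈ ∂²g_i(x̄)(ū)} ≥ 0; (iii) λ_l = 0 for every l ∉ L(x̄; ū); (iv) μ_i = 0 for every i ∉ I(x̄; ū); (v) Σ_{l=1}^m λ_l ⟨∇f_l(x̄), w⟩ ≥ 0 for every w ∈ 𝒞(x̄, ū) with ⟨ū, w⟩ = 0. -/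

import Mathlib

open Filter Topology RealInnerProductSpace

noncomputable section

/-- `ℝⁿ` with the Euclidean structure. -/
abbrev En (n : ℕ) : Type := EuclideanSpace ℝ (Fin n)

/-- `φ` is of class `C^{1,1}`: Fréchet differentiable with locally Lipschitz gradient. -/
def IsC11 {n : ℕ} (φ : En n → ℝ) : Prop :=
  Differentiable ℝ φ ∧ LocallyLipschitz (fun x => gradient φ x)

/-- Fréchet subdifferential of `h` at `x`. -/
def frechetSubdiff {n : ℕ} (h : En n → ℝ) (x : En n) : Set (En n) :=
  {v | 0 ≤ Filter.liminf (fun y => (h y - h x - ⟪v, y - x⟫) / ‖y - x‖) (𝓝[≠] x)}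

/-- Limiting (Mordukhovich) subdifferential of `h` at `xb`. -/
def limitingSubdiff {n : ℕ} (h : En n → ℝ) (xb : En n) : Set (En n) :=
  {v | ∃ x : ℕ → En n, ∃ w : ℕ → En n,
      Tendsto x atTop (𝓝 xb) ∧ Tendsto w atTop (𝓝 v) ∧
      ∀ k, w k ∈ frechetSubdiff h (x k)}

/-- Limiting second-order subdifferential `∂²φ(xb)(u) = ∂⟨u, ∇φ⟩(xb)`. -/
def secondSubdiff {n : ℕ} (φ : En n → ℝ) (xb u : En n) : Set (En n) :=
  limitingSubdiff (fun x => ⟪u, gradient φ x⟫) xb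

/-- `max{⟨ζ, u⟩ : ζ ∈ ∂²φ(xb)(u)}`. -/
def d2max {n : ℕ} (φ : En n → ℝ) (xb u : En n) : ℝ :=
  sSup ((fun ζ => ⟪ζ, u⟫) '' secondSubdiff φ xb u)

/-- `min{⟨ζ, u⟩ : ζ ∈ ∂²φ(xb)(u)}`. -/
def d2min {n : ℕ} (φ : En n → ℝ) (xb u : En n) : ℝ :=
  sInf ((fun ζ => ⟪ζ, u⟫) '' secondSubdiff φ xb u)

/-- Tangent cone (via sequences). -/
def tangentCone {n : ℕ} (Ω : Set (En n)) (xb : En n) : Set (En n) :=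
  {d | ∃ t : ℕ → ℝ, ∃ dk : ℕ → En n,
      (∀ k, 0 < t k) ∧ Tendsto t atTop (𝓝 0) ∧ Tendsto dk atTop (𝓝 d) ∧
      ∀ k, xb + t k • dk k ∈ Ω}

/-- Second-order tangent set. -/
def secondTangent {n : ℕ} (Ω : Set (En n)) (xb u : En n) : Set (En n) :=
  {v | ∃ t : ℕ → ℝ, ∃ vk : ℕ → En n,
      (∀ k, 0 < t k) ∧ Tendsto t atTop (𝓝 0) ∧ Tendsto vk atTop (𝓝 v) ∧
      ∀ k, xb + t k • u + ((1 : ℝ) / 2 * (t k) ^ 2) • vk k ∈ Ω}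

/-- Lexicographic `≤` on `ℝ²`. -/
def lexLe (a b : ℝ × ℝ) : Prop := a.1 < b.1 ∨ (a.1 = b.1 ∧ a.2 ≤ b.2)

/-- Lexicographic `<` on `ℝ²`. -/
def lexLt (a b : ℝ × ℝ) : Prop := a.1 < b.1 ∨ (a.1 = b.1 ∧ a.2 < b.2)

/-- The set `L²(X; x̄, u)` associated with the constraints `g_i ≤ 0`. -/
def L2set {n p : ℕ} (g : Fin p → En n → ℝ) (xb u : En n) : Set (En n) :=
  {v | ∀ i, g i xb = 0 →
      lexLe (⟪gradient (g i) xb, u⟫, ⟪gradient (g i) xb, v⟫ + d2max (g i) xb u) (0, 0)}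

/-- `u` is a critical direction of (VOP) at `x̄`. -/
def IsCriticalDir {n m p : ℕ} (f : Fin m → En n → ℝ) (g : Fin p → En n → ℝ)
    (xb u : En n) : Prop :=
  (∀ l, ⟪gradient (f l) xb, u⟫ ≤ 0) ∧ (∃ l, ⟪gradient (f l) xb, u⟫ = 0) ∧
    (∀ i, g i xb = 0 → ⟪gradient (g i) xb, u⟫ ≤ 0)


theorem farkas_aux {V ι : Type*} [AddCommGroup V] [Module ℝ V] [DecidableEq ι] (s : Finset ι) :
    ∀ (a : ι → V →ₗ[ℝ] ℝ) (b : V →ₗ[ℝ] ℝ),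
      (∀ x, (∀ i ∈ s, a i x ≤ 0) → b x ≤ 0) →
      ∃ c : ι → ℝ, (∀ i, 0 ≤ c i) ∧ ∀ x, b x = ∑ i ∈ s, c i * a i x := by
  induction s using Finset.induction_on with
  | empty =>
    intro a b h
    refine ⟨fun _ => 0, fun _ => le_rfl, fun x => ?_⟩
    have h1 := h x (by simp)
    have h2 := h (-x) (by simp)
    simp at h2 ⊢
    linarith
  | insert j s hj ih =>
    intro a b h
    by_cases hs : ∀ x, (∀ i ∈ s, a i x ≤ 0) → b x ≤ 0
    · obtain ⟨c, hc, hb⟩ := ih a b hs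
      refine ⟨fun i => if i = j then 0 else c i, fun i => ?_, fun x => ?_⟩
      · dsimp only
        split_ifs
        · exact le_rfl
        · exact hc i
      · rw [Finset.sum_insert hj, hb x]
        simp only [if_true, zero_mul, zero_add]
        refine Finset.sum_congr rfl fun i hi => ?_
        rw [if_neg (ne_of_mem_of_not_mem hi hj)]
    · push Not at hs
      obtain ⟨x1, hx1, hbx1⟩ := hs
      have haj : 0 < a j x1 := by
        by_contra hcon
        push Not at hcon
        have := h x1 (by
          intro i hi
          rcases Finset.mem_insert.1 hi with rfl | hi
          · exact hcon
          · exact hx1 i hi)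
        linarith
      set x0 : V := (a j x1)⁻¹ • x1 with hx0
      have e1 : a j x0 = 1 := by simp [hx0, haj.ne']
      have e2 : ∀ i ∈ s, a i x0 ≤ 0 := by
        intro i hi
        simp only [hx0, map_smul, smul_eq_mul]
        exact mul_nonpos_of_nonneg_of_nonpos (inv_nonneg.2 haj.le) (hx1 i hi)
      have e3 : 0 < b x0 := by
        simp only [hx0, map_smul, smul_eq_mul]
        positivity
      obtain ⟨c, hc, hb⟩ := ih (fun i => a i - (a i x0) • a j) (b - (b x0) • a j) (by
        intro x hx
        have := h (x - (a j x) • x0) (by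
          intro i hi
          rcases Finset.mem_insert.1 hi with rfl | hi
          · simp [e1]
          · have := hx i hi
            simp at this ⊢
            linarith)
        simp at this ⊢
        linarith)
      refine ⟨fun i => if i = j then b x0 - ∑ i ∈ s, c i * a i x0 else c i, fun i => ?_, fun x => ?_⟩
      · dsimp only
        split_ifs
        · have : ∑ i ∈ s, c i * a i x0 ≤ 0 :=
            Finset.sum_nonpos fun i hi => mul_nonpos_of_nonneg_of_nonpos (hc i) (e2 i hi)
          linarith
        · exact hc i
      · rw [Finset.sum_insert hj]
        have h1 : ∑ i ∈ s, (if i = j then b x0 - ∑ i ∈ s, c i * a i x0 else c i) * a i x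
            = ∑ i ∈ s, c i * a i x := by
          refine Finset.sum_congr rfl fun i hi => ?_
          rw [if_neg (ne_of_mem_of_not_mem hi hj)]
        rw [h1]
        have h2 := hb x
        simp only [LinearMap.sub_apply, LinearMap.smul_apply, smul_eq_mul, if_true, mul_sub,
          Finset.sum_sub_distrib] at h2 ⊢
        have h3 : ∑ i ∈ s, c i * (a i x0 * a j x) = (∑ i ∈ s, c i * a i x0) * a j x := by
          rw [Finset.sum_mul]
          exact Finset.sum_congr rfl fun i _ => by ring
        rw [h3] at h2
        linarith

theorem alt_aux {n m p : ℕ} (a : Fin m → En n) (α : Fin m → ℝ) (b : Fin p → En n) (β : Fin p → ℝ)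
    (S : Fin m → Prop) (T : Fin p → Prop)
    (h : ¬ ∃ v : En n, (∀ l, S l → ⟪a l, v⟫ + α l < 0) ∧ (∀ i, T i → ⟪b i, v⟫ + β i ≤ 0)) :
    ∃ (lam : Fin m → ℝ) (mu : Fin p → ℝ) (c0 : ℝ), (∀ l, 0 ≤ lam l) ∧ (∀ i, 0 ≤ mu i) ∧ 0 ≤ c0 ∧
      (∑ l, lam l) + c0 = 1 ∧ (∀ l, ¬ S l → lam l = 0) ∧ (∀ i, ¬ T i → mu i = 0) ∧
      (∑ l, lam l • a l) + (∑ i, mu i • b i) = 0 ∧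
      (∑ l, lam l * α l) + (∑ i, mu i * β i) = c0 := by
  classical
  let P1 : (En n × ℝ × ℝ) →ₗ[ℝ] En n := LinearMap.fst ℝ _ _
  let P2 : (En n × ℝ × ℝ) →ₗ[ℝ] ℝ := LinearMap.fst ℝ _ _ ∘ₗ LinearMap.snd ℝ _ _
  let P3 : (En n × ℝ × ℝ) →ₗ[ℝ] ℝ := LinearMap.snd ℝ _ _ ∘ₗ LinearMap.snd ℝ _ _
  let F : (Option (Fin m) ⊕ Fin p) → (En n × ℝ × ℝ) →ₗ[ℝ] ℝ := fun k =>
    match k with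
    | .inl none => -P2 + P3
    | .inl (some l) => if S l then (innerₛₗ ℝ (a l)) ∘ₗ P1 + (α l) • P2 + P3 else 0
    | .inr i => if T i then (innerₛₗ ℝ (b i)) ∘ₗ P1 + (β i) • P2 else 0
  obtain ⟨c, hc, hb⟩ := farkas_aux Finset.univ F P3 (by
    rintro ⟨v, τ, t⟩ hx
    by_contra hcon
    have ht : 0 < t := by simpa [P3] using hcon
    have hτ : t ≤ τ := by
      have := hx (.inl none) (Finset.mem_univ _)
      simp [F, P2, P3] at this
      linarith
    have hτ0 : 0 < τ := by linarith
    apply h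
    refine ⟨τ⁻¹ • v, fun l hl => ?_, fun i hi => ?_⟩
    · have := hx (.inl (some l)) (Finset.mem_univ _)
      simp [F, P1, P2, P3, hl] at this
      rw [inner_smul_right]
      have e : τ⁻¹ * ⟪a l, v⟫ + α l = τ⁻¹ * (⟪a l, v⟫ + α l * τ) := by field_simp
      rw [e]
      exact mul_neg_of_pos_of_neg (inv_pos.2 hτ0) (by linarith)
    · have := hx (.inr i) (Finset.mem_univ _)
      simp [F, P1, P2, hi] at this
      rw [inner_smul_right]
      have e : τ⁻¹ * ⟪b i, v⟫ + β i = τ⁻¹ * (⟪b i, v⟫ + β i * τ) := by field_simp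
      rw [e]
      exact mul_nonpos_of_nonneg_of_nonpos (inv_pos.2 hτ0).le (by linarith))
  simp only [Fintype.sum_sum_type, Fintype.sum_option] at hb
  set lam : Fin m → ℝ := fun l => if S l then c (.inl (some l)) else 0 with hlam
  set mu : Fin p → ℝ := fun i => if T i then c (.inr i) else 0 with hmu
  have key : ∀ (v : En n) (τ t : ℝ), t = c (.inl none) * (-τ + t) +
      ∑ l, lam l * (⟪a l, v⟫ + α l * τ + t) + ∑ i, mu i * (⟪b i, v⟫ + β i * τ) := by
    intro v τ t
    have := hb (v, τ, t)
    have e1 : ∀ l, lam l * (⟪a l, v⟫ + α l * τ + t) = c (.inl (some l)) * F (.inl (some l)) (v, τ, t) := by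
      intro l
      by_cases hl : S l <;> simp [F, hl, hlam, P1, P2, P3]
    have e2 : ∀ i, mu i * (⟪b i, v⟫ + β i * τ) = c (.inr i) * F (.inr i) (v, τ, t) := by
      intro i
      by_cases hl : T i <;> simp [F, hl, hmu, P1, P2]
    simp only [e1, e2]
    simpa [F, P2, P3] using this
  refine ⟨lam, mu, c (.inl none), fun l => ?_, fun i => ?_, hc _, ?_, fun l hl => ?_, fun i hi => ?_, ?_, ?_⟩
  · simp only [hlam]; split_ifs <;> simp [hc]
  · simp only [hmu]; split_ifs <;> simp [hc]
  · have := key 0 0 1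
    simp at this
    linarith
  · simp [hlam, hl]
  · simp [hmu, hi]
  · refine ext_inner_right ℝ fun v => ?_
    have := key v 0 0
    simp at this
    simp only [inner_add_left, sum_inner, inner_smul_left, inner_zero_left]
    simp
    linarith
  · have := key 0 1 0
    simp at this
    linarith

theorem min_sq_aux (x y : ℝ) :
    (min x 0) ^ 2 ≤ (min y 0) ^ 2 + 2 * min y 0 * (x - y) + (x - y) ^ 2 := by
  rcases le_total x 0 with h1 | h1 <;> rcases le_total y 0 with h2 | h2 <;>
    simp only [min_eq_left, min_eq_right, h1, h2] <;> nlinarith [sq_nonneg (x - y)]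

set_option maxHeartbeats 1000000 in
theorem mvi_aux {n : ℕ} (φ : En n → ℝ) (a u : En n) (R L s c : ℝ) (hL : 0 ≤ L)
    (hφ : ∀ x ∈ Metric.closedBall a R, ∀ y ∈ Metric.closedBall a R, |φ x - φ y| ≤ L * ‖x - y‖)
    (hu : u ≠ 0) (hs : 0 < s) (hsR : s * ‖u‖ < R) (hgap : c * s < φ (a + s • u) - φ a) :
    ∃ y ∈ Metric.ball a R, ∃ v : En n, ∃ C : ℝ, c ≤ ⟪v, u⟫ ∧
      ∀ᶠ x in 𝓝 y, ⟪v, x - y⟫ - C * ‖x - y‖ ^ 2 ≤ φ x - φ y := by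
  have hu0 : 0 < ‖u‖ := norm_pos_iff.2 hu
  have hR : 0 < R := lt_trans (by positivity) hsR
  obtain ⟨e, he⟩ : ∃ e : En n, e = (‖u‖ ^ 2)⁻¹ • u := ⟨_, rfl⟩
  have heu : ⟪e, u⟫ = 1 := by
    rw [he, real_inner_smul_left, real_inner_self_eq_norm_sq]; field_simp
  let τ : En n → ℝ := fun y => ⟪e, y - a⟫
  let z : En n → En n := fun y => y - a - (τ y) • u
  have hτc : Continuous τ := by fun_prop
  have hzc : Continuous z := by fun_prop
  have hzu : ∀ y, ⟪z y, u⟫ = 0 := by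
    intro y
    simp only [z, τ]
    rw [inner_sub_left, real_inner_smul_left, real_inner_self_eq_norm_sq, he, real_inner_smul_left,
      real_inner_comm]
    field_simp
    ring
  have hza : ∀ y, y = a + τ y • u + z y := by intro y; simp only [z]; abel
  have hτa : τ a = 0 := by simp [τ]
  have hza0 : z a = 0 := by simp [z, hτa]
  have hb : a + s • u ∈ Metric.closedBall a R := by
    simp [Metric.mem_closedBall, dist_eq_norm, norm_smul, abs_of_pos hs, hsR.le]
  have haB : a ∈ Metric.closedBall a R := Metric.mem_closedBall_self hR.le
  -- choose parameters
  obtain ⟨η, hη0, hη1, hη2⟩ : ∃ η > 0, η + (s + η) * ‖u‖ < R ∧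
      L * η < φ (a + s • u) - φ a - c * s := by
    have t1 : Tendsto (fun η : ℝ => η + (s + η) * ‖u‖) (𝓝[>] 0) (𝓝 (0 + (s + 0) * ‖u‖)) :=
      ((by fun_prop : Continuous (fun η : ℝ => η + (s + η) * ‖u‖)).tendsto 0).mono_left nhdsWithin_le_nhds
    have t2 : Tendsto (fun η : ℝ => L * η) (𝓝[>] 0) (𝓝 (L * 0)) :=
      ((by fun_prop : Continuous (fun η : ℝ => L * η)).tendsto 0).mono_left nhdsWithin_le_nhds
    have h1 := t1.eventually_lt_const (show 0 + (s + 0) * ‖u‖ < R by simpa using hsR)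
    have h2 := t2.eventually_lt_const
      (show L * 0 < φ (a + s • u) - φ a - c * s by linarith)
    obtain ⟨η, h⟩ := (h1.and (h2.and self_mem_nhdsWithin)).exists
    exact ⟨η, h.2.2, h.1, h.2.1⟩
  set M : ℝ := L * R + |c| * (‖e‖ * R) + 1 with hM
  have hM0 : 0 < M := by positivity
  set K : ℝ := M / η ^ 2 with hK
  have hK0 : 0 < K := by positivity
  let q : En n → ℝ := fun y => ‖z y‖ ^ 2 + (min (τ y) 0) ^ 2
  let G : En n → ℝ := fun y => φ y - c * τ y + K * q y
  have hGa : G a = φ a := by simp [G, q, hτa, hza0]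
  let D : Set (En n) := Metric.closedBall a R ∩ {y | τ y ≤ s}
  have hDc : IsCompact D :=
    (isCompact_closedBall a R).inter_right (isClosed_le hτc continuous_const)
  have haD : a ∈ D := ⟨haB, by simp [hτa, hs.le]⟩
  have hφc : ContinuousOn φ (Metric.closedBall a R) := by
    have : LipschitzOnWith L.toNNReal φ (Metric.closedBall a R) := by
      refine LipschitzOnWith.of_dist_le_mul fun x hx y hy => ?_
      rw [Real.dist_eq, dist_eq_norm, Real.coe_toNNReal L hL]
      exact hφ x hx y hy
    exact this.continuousOn
  have hGc : ContinuousOn G D := by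
    have hqc : Continuous (fun y => c * τ y) := by fun_prop
    have hqc2 : Continuous (fun y => K * q y) := by fun_prop
    exact ((hφc.mono Set.inter_subset_left).sub hqc.continuousOn).add hqc2.continuousOn
  obtain ⟨y, hyD, hymin⟩ := hDc.exists_isMinOn ⟨a, haD⟩ hGc
  have hyB : ‖y - a‖ ≤ R := by simpa [dist_eq_norm] using hyD.1
  have hGy : G y ≤ φ a := hGa ▸ hymin haD
  have hqy : q y ≤ η ^ 2 := by
    have h1 : |φ y - φ a| ≤ L * ‖y - a‖ := hφ y hyD.1 a haB
    have h2 : |c * τ y| ≤ |c| * (‖e‖ * R) := by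
      rw [abs_mul]
      gcongr
      exact (abs_real_inner_le_norm _ _).trans (by gcongr)
    have h3 : L * ‖y - a‖ ≤ L * R := by gcongr
    have h4 : K * q y ≤ M := by
      have := abs_le.1 h1
      have := abs_le.1 h2
      simp only [G] at hGy
      linarith [this.1, this.2]
    rw [hK] at h4
    rw [div_mul_eq_mul_div, div_le_iff₀ (by positivity)] at h4
    exact le_of_mul_le_mul_left h4 hM0
  have hz : ‖z y‖ ≤ η := by
    refine abs_le_of_sq_le_sq' ?_ hη0.le |>.2
    simp only [q] at hqy
    nlinarith [sq_nonneg (min (τ y) 0)]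
  have hτl : -η ≤ τ y := by
    have : -η ≤ min (τ y) 0 := by
      refine abs_le_of_sq_le_sq' ?_ hη0.le |>.1
      simp only [q] at hqy
      nlinarith [sq_nonneg ‖z y‖]
    exact this.trans (min_le_left _ _)
  have hτs : τ y ≤ s := hyD.2
  have hyR : ‖y - a‖ < R := by
    have e1 : y - a = z y + τ y • u := by simp only [z]; abel
    have e2 : |τ y| ≤ s + η := abs_le.2 ⟨by linarith, by linarith⟩
    calc ‖y - a‖ ≤ ‖z y‖ + ‖τ y • u‖ := by rw [e1]; exact norm_add_le _ _
      _ = ‖z y‖ + |τ y| * ‖u‖ := by rw [norm_smul, Real.norm_eq_abs]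
      _ ≤ η + (s + η) * ‖u‖ := by gcongr
      _ < R := hη1
  have hq0 : ∀ y, 0 ≤ q y := fun y => by positivity
  have hτs' : τ y < s := by
    refine lt_of_le_of_ne hτs fun heq => ?_
    have h1 := hφ y hyD.1 _ hb
    have e1 : y - (a + s • u) = z y := by simp only [z, heq]; abel
    rw [e1] at h1
    have h2 : L * ‖z y‖ ≤ L * η := by gcongr
    have h3 := (abs_le.1 h1).1
    have h4 : 0 ≤ K * q y := mul_nonneg hK0.le (hq0 y)
    simp only [G, heq] at hGy
    linarith
  set w : ℝ := min (τ y) 0 with hw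
  have hvi : ∀ d : En n, ⟪c • e - K • ((2 : ℝ) • z y + (2 * w) • e), d⟫
      = c * ⟪e, d⟫ - K * (2 * ⟪z y, d⟫ + 2 * w * ⟪e, d⟫) := by
    intro d
    rw [inner_sub_left, real_inner_smul_left, real_inner_smul_left, inner_add_left,
      real_inner_smul_left, real_inner_smul_left]
  refine ⟨y, by simpa [dist_eq_norm] using hyR, c • e - K • ((2 : ℝ) • z y + (2 * w) • e),
    K * (1 + ‖e‖ ^ 2), ?_, ?_⟩
  · rw [hvi, heu, hzu]
    have hw0 : w ≤ 0 := min_le_right _ _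
    have : K * w ≤ 0 := mul_nonpos_of_nonneg_of_nonpos hK0.le hw0
    linarith
  · have ev1 : ∀ᶠ x in 𝓝 y, x ∈ Metric.ball a R :=
      Metric.isOpen_ball.mem_nhds (by simpa [dist_eq_norm] using hyR)
    have ev2 : ∀ᶠ x in 𝓝 y, τ x < s := hτc.continuousAt.eventually_lt_const hτs'
    filter_upwards [ev1, ev2] with x hx1 hx2
    have hm : G y ≤ G x := hymin (show x ∈ D from ⟨Metric.ball_subset_closedBall hx1, hx2.le⟩)
    have hτd : τ x - τ y = ⟪e, x - y⟫ := by
      simp only [τ]; rw [← inner_sub_right]; congr 1; abel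
    have hzd : z x - z y = (x - y) - ⟪e, x - y⟫ • u := by
      rw [← hτd, sub_smul]; simp only [z]; abel
    have hzz : ‖z x‖ ^ 2 = ‖z y‖ ^ 2 + 2 * ⟪z y, x - y⟫ + ‖z x - z y‖ ^ 2 := by
      have e1 : z x = z y + (z x - z y) := by abel
      have e2 : ⟪z y, z x - z y⟫ = ⟪z y, x - y⟫ := by
        rw [hzd, inner_sub_right, real_inner_smul_right, hzu]; ring
      conv_lhs => rw [e1, norm_add_sq_real, e2]
    have hzn : ‖z x - z y‖ ^ 2 ≤ ‖x - y‖ ^ 2 := by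
      have e1 : x - y = (z x - z y) + ⟪e, x - y⟫ • u := by rw [hzd]; abel
      have e2 : ⟪z x - z y, ⟪e, x - y⟫ • u⟫ = 0 := by
        rw [real_inner_smul_right, inner_sub_left, hzu, hzu]; ring
      have e3 : ‖x - y‖ ^ 2 = ‖z x - z y‖ ^ 2 + ‖⟪e, x - y⟫ • u‖ ^ 2 := by
        conv_lhs => rw [e1, norm_add_sq_real, e2]
        ring
      rw [e3]
      nlinarith [sq_nonneg ‖⟪e, x - y⟫ • u‖]
    have hww : (min (τ x) 0) ^ 2 ≤ w ^ 2 + 2 * w * ⟪e, x - y⟫ + ⟪e, x - y⟫ ^ 2 := by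
      rw [← hτd, hw]
      exact min_sq_aux _ _
    have hen : ⟪e, x - y⟫ ^ 2 ≤ ‖e‖ ^ 2 * ‖x - y‖ ^ 2 := by
      rw [← mul_pow]
      exact sq_le_sq.2 ((abs_real_inner_le_norm _ _).trans (le_abs_self _))
    have hq : q x - q y ≤ 2 * ⟪z y, x - y⟫ + 2 * w * ⟪e, x - y⟫ + (1 + ‖e‖ ^ 2) * ‖x - y‖ ^ 2 := by
      simp only [q]
      rw [hzz]
      linarith
    have hKq := mul_le_mul_of_nonneg_left hq hK0.le
    have hcτ : c * τ x - c * τ y = c * ⟪e, x - y⟫ := by rw [← hτd]; ring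
    rw [hvi]
    change φ y - c * τ y + K * q y ≤ φ x - c * τ x + K * q x at hm
    linarith

theorem frechet_of_quad {n : ℕ} (φ : En n → ℝ) (y v : En n) (C L : ℝ) [Nontrivial (En n)]
    (hL : ∀ᶠ x in 𝓝 y, |φ x - φ y| ≤ L * ‖x - y‖)
    (h : ∀ᶠ x in 𝓝 y, ⟪v, x - y⟫ - C * ‖x - y‖ ^ 2 ≤ φ x - φ y) :
    v ∈ frechetSubdiff φ y := by
  have : (𝓝[≠] y).NeBot := Module.punctured_nhds_neBot ℝ (En n) y
  have hbd : IsBoundedUnder (· ≤ ·) (𝓝[≠] y) (fun x => (φ x - φ y - ⟪v, x - y⟫) / ‖x - y‖) := by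
    refine ⟨L + ‖v‖, ?_⟩
    rw [eventually_map]
    filter_upwards [nhdsWithin_le_nhds hL, self_mem_nhdsWithin] with x hx hne
    have hp : 0 < ‖x - y‖ := norm_pos_iff.2 (sub_ne_zero.2 hne)
    rw [div_le_iff₀ hp]
    have := (abs_le.1 hx).2
    have := (abs_le.1 (abs_real_inner_le_norm v (x - y))).1
    linarith
  show 0 ≤ Filter.liminf (fun x => (φ x - φ y - ⟪v, x - y⟫) / ‖x - y‖) (𝓝[≠] y)
  refine le_of_forall_pos_le_add fun ε hε => ?_
  have : -ε ≤ Filter.liminf (fun x => (φ x - φ y - ⟪v, x - y⟫) / ‖x - y‖) (𝓝[≠] y) := by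
    refine le_liminf_of_le hbd.isCoboundedUnder_ge ?_
    have hsm : ∀ᶠ x in 𝓝 y, C * ‖x - y‖ < ε := by
      have : Continuous (fun x : En n => C * ‖x - y‖) := by fun_prop
      exact this.continuousAt.eventually_lt_const (by simpa using hε)
    filter_upwards [nhdsWithin_le_nhds h, nhdsWithin_le_nhds hsm, self_mem_nhdsWithin] with x hx hs hne
    have hp : 0 < ‖x - y‖ := norm_pos_iff.2 (sub_ne_zero.2 hne)
    rw [le_div_iff₀ hp]
    nlinarith
  linarith

theorem frechet_norm_le {n : ℕ} (φ : En n → ℝ) (y v : En n) (L : ℝ) (hL0 : 0 ≤ L)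
    (hL : ∀ᶠ x in 𝓝 y, |φ x - φ y| ≤ L * ‖x - y‖) (hv : v ∈ frechetSubdiff φ y) : ‖v‖ ≤ L := by
  by_cases hv0 : v = 0
  · simpa [hv0] using hL0
  have hvp : 0 < ‖v‖ := norm_pos_iff.2 hv0
  have hbd : IsBoundedUnder (· ≥ ·) (𝓝[≠] y) (fun x => (φ x - φ y - ⟪v, x - y⟫) / ‖x - y‖) := by
    refine ⟨-(L + ‖v‖), ?_⟩
    rw [eventually_map]
    filter_upwards [nhdsWithin_le_nhds hL, self_mem_nhdsWithin] with x hx hne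
    have hp : 0 < ‖x - y‖ := norm_pos_iff.2 (sub_ne_zero.2 hne)
    show _ ≤ _
    rw [le_div_iff₀ hp]
    have := (abs_le.1 hx).1
    have := (abs_le.1 (abs_real_inner_le_norm v (x - y))).2
    linarith
  refine le_of_forall_pos_le_add fun ε hε => ?_
  have hlt : -ε < Filter.liminf (fun x => (φ x - φ y - ⟪v, x - y⟫) / ‖x - y‖) (𝓝[≠] y) :=
    lt_of_lt_of_le (by linarith) hv
  have hev := eventually_lt_of_lt_liminf hlt hbd
  have ht : Tendsto (fun t : ℝ => y + t • v) (𝓝[>] 0) (𝓝[≠] y) := by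
    refine tendsto_nhdsWithin_iff.2 ⟨?_, ?_⟩
    · have : Continuous (fun t : ℝ => y + t • v) := by fun_prop
      have := (this.tendsto 0).mono_left (nhdsWithin_le_nhds (s := Set.Ioi 0))
      simpa using this
    · filter_upwards [self_mem_nhdsWithin] with t ht
      have : t ≠ 0 := ne_of_gt ht
      simp [this, hv0]
  obtain ⟨t, ⟨h1, h2⟩, h3⟩ := (((ht.eventually hev).and
    ((ht.mono_right nhdsWithin_le_nhds).eventually hL)).and self_mem_nhdsWithin).exists
  have h3 : 0 < t := h3
  simp only [add_sub_cancel_left, norm_smul, real_inner_smul_right, real_inner_self_eq_norm_sq,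
    Real.norm_eq_abs, abs_of_pos h3] at h1 h2
  rw [lt_div_iff₀ (by positivity)] at h1
  have h4 := (abs_le.1 h2).2
  have h5 : (t * ‖v‖) * ‖v‖ ≤ (t * ‖v‖) * (L + ε) := by nlinarith
  exact le_of_mul_le_mul_left h5 (by positivity)

theorem dini_aux {n : ℕ} (φ : En n → ℝ) (hφ : LocallyLipschitz φ) (xb u : En n) (hu : u ≠ 0) (c : ℝ)
    (hc : sSup ((fun ζ => ⟪ζ, u⟫) '' limitingSubdiff φ xb) < c) :
    ∀ᶠ s in 𝓝[>] (0 : ℝ), φ (xb + s • u) - φ xb ≤ c * s := by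
  have : Nontrivial (En n) := ⟨⟨u, 0, hu⟩⟩
  obtain ⟨K, t, ht, hK⟩ := hφ xb
  obtain ⟨R, hR, hRt⟩ := Metric.nhds_basis_closedBall.mem_iff.1 ht
  have hLip : ∀ x ∈ Metric.closedBall xb R, ∀ y ∈ Metric.closedBall xb R,
      |φ x - φ y| ≤ K * ‖x - y‖ := by
    intro x hx y hy
    have := hK.dist_le_mul x (hRt hx) y (hRt hy)
    rwa [Real.dist_eq, dist_eq_norm] at this
  have hLoc : ∀ y ∈ Metric.ball xb R, ∀ᶠ x in 𝓝 y, |φ x - φ y| ≤ K * ‖x - y‖ := by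
    intro y hy
    filter_upwards [Metric.isOpen_ball.mem_nhds hy] with x hx
    exact hLip x (Metric.ball_subset_closedBall hx) y (Metric.ball_subset_closedBall hy)
  have hbdd : BddAbove ((fun ζ => ⟪ζ, u⟫) '' limitingSubdiff φ xb) := by
    refine ⟨K * ‖u‖, ?_⟩
    rintro _ ⟨ζ, ⟨x, w, hx, hw, hxw⟩, rfl⟩
    have h1 : ∀ᶠ k in atTop, ‖w k‖ ≤ K := by
      filter_upwards [hx.eventually (Metric.ball_mem_nhds xb hR)] with k hk
      exact frechet_norm_le φ (x k) (w k) K K.2 (hLoc _ hk) (hxw k)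
    have h2 : ‖ζ‖ ≤ K := le_of_tendsto hw.norm h1
    exact (real_inner_le_norm _ _).trans (by gcongr)
  by_contra hcon
  rw [not_eventually] at hcon
  have hstep : ∀ k : ℕ, ∃ y ∈ Metric.ball xb (R / (k + 1)), ∃ v, v ∈ frechetSubdiff φ y ∧
      c ≤ ⟪v, u⟫ ∧ ‖v‖ ≤ K := by
    intro k
    have hRk : 0 < R / (k + 1 : ℝ) := by positivity
    have hRk' : R / (k + 1 : ℝ) ≤ R := div_le_self hR.le (by linarith [(Nat.cast_nonneg k : (0:ℝ) ≤ k)])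
    have hsm : ∀ᶠ s in 𝓝[>] (0 : ℝ), s * ‖u‖ < R / (k + 1) := by
      have : Continuous (fun s : ℝ => s * ‖u‖) := by fun_prop
      exact nhdsWithin_le_nhds (this.continuousAt.eventually_lt_const (by simpa using hRk))
    obtain ⟨s, hs1, hs2, hs3⟩ := (hcon.and_eventually (hsm.and self_mem_nhdsWithin)).exists
    have hsub : Metric.closedBall xb (R / (k + 1)) ⊆ Metric.closedBall xb R :=
      Metric.closedBall_subset_closedBall hRk'
    obtain ⟨y, hy, v, C, hcv, hev⟩ := mvi_aux φ xb u (R / (k + 1)) K s c K.2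
      (fun x hx y hy => hLip x (hsub hx) y (hsub hy)) hu hs3 hs2 (not_le.1 hs1)
    have hyR : y ∈ Metric.ball xb R := Metric.ball_subset_ball hRk' hy
    have hvF := frechet_of_quad φ y v C K (hLoc y hyR) hev
    exact ⟨y, hy, v, hvF, hcv, frechet_norm_le φ y v K K.2 (hLoc y hyR) hvF⟩
  choose y hy v hv hcv hvK using hstep
  have hyt : Tendsto y atTop (𝓝 xb) := by
    rw [tendsto_iff_dist_tendsto_zero]
    refine squeeze_zero (fun _ => dist_nonneg) (fun k => (hy k).le) ?_
    have := tendsto_const_div_atTop_nhds_zero_nat R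
    have := (tendsto_add_atTop_iff_nat 1).2 this
    simpa using this
  obtain ⟨ζ, -, σ, hσ, hζ⟩ := (isCompact_closedBall (0 : En n) K).tendsto_subseq
    (x := v) (fun k => by simpa using hvK k)
  have hmem : ζ ∈ limitingSubdiff φ xb :=
    ⟨y ∘ σ, v ∘ σ, hyt.comp hσ.tendsto_atTop, hζ, fun k => hv _⟩
  have h1 : ⟪ζ, u⟫ ≤ sSup ((fun ζ => ⟪ζ, u⟫) '' limitingSubdiff φ xb) :=
    le_csSup hbdd ⟨ζ, hmem, rfl⟩
  have h2 : c ≤ ⟪ζ, u⟫ := by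
    have : Tendsto (fun k => ⟪v (σ k), u⟫) atTop (𝓝 ⟪ζ, u⟫) := hζ.inner tendsto_const_nhds
    exact ge_of_tendsto' this fun k => hcv _
  linarith

theorem d2max_zero {n : ℕ} (φ : En n → ℝ) (xb : En n) : d2max φ xb 0 = 0 := by
  unfold d2max
  simp only [inner_zero_right]
  rcases Set.eq_empty_or_nonempty (secondSubdiff φ xb 0) with h | h
  · simp [h]
  · rw [h.image_const]; simp

theorem taylor_aux {n : ℕ} (φ : En n → ℝ) (hφ : IsC11 φ) (xb u : En n) (c : ℝ)
    (hc : d2max φ xb u < c) :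
    ∀ᶠ t in 𝓝[>] (0 : ℝ), φ (xb + t • u) ≤ φ xb + t * ⟪gradient φ xb, u⟫ + c * t ^ 2 / 2 := by
  have hd : ∀ᶠ s in 𝓝[>] (0 : ℝ),
      ⟪u, gradient φ (xb + s • u)⟫ - ⟪u, gradient φ xb⟫ ≤ c * s := by
    by_cases hu : u = 0
    · subst hu
      rw [d2max_zero] at hc
      filter_upwards [self_mem_nhdsWithin] with s hs
      have hs : 0 < s := hs
      simp only [inner_zero_left]
      nlinarith
    · refine dini_aux (fun x => ⟪u, gradient φ x⟫) ?_ xb u hu c hc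
      exact ((innerSL ℝ u).lipschitz.locallyLipschitz).comp hφ.2
  obtain ⟨δ, hδ, hδs⟩ := mem_nhdsGT_iff_exists_Ioo_subset.1 hd
  filter_upwards [Ioo_mem_nhdsGT hδ] with t ht
  have hder : ∀ s : ℝ, HasDerivAt (fun s : ℝ => φ (xb + s • u) - s * ⟪gradient φ xb, u⟫ - c * s ^ 2 / 2)
      (⟪gradient φ (xb + s • u), u⟫ - ⟪gradient φ xb, u⟫ - c * s) s := by
    intro s
    have h1 : HasDerivAt (fun s : ℝ => xb + s • u) u s := by
      simpa using ((hasDerivAt_id s).smul_const u).const_add xb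
    have h2 := (hφ.1 (xb + s • u)).hasGradientAt.hasFDerivAt.comp_hasDerivAt s h1
    have h3 : HasDerivAt (fun s : ℝ => s * ⟪gradient φ xb, u⟫) (1 * ⟪gradient φ xb, u⟫) s :=
      (hasDerivAt_id s).mul_const _
    have h4 : HasDerivAt (fun s : ℝ => c * s ^ 2 / 2) (c * s) s := by
      have h5 := ((hasDerivAt_pow 2 s).const_mul c).div_const 2
      have h6 : c * ((2 : ℕ) * s ^ (2 - 1)) / 2 = c * s := by norm_num; ring
      rw [h6] at h5
      exact h5
    have h7 := (h2.sub h3).sub h4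
    rw [one_mul, InnerProductSpace.toDual_apply_apply] at h7
    exact h7
  have hanti : AntitoneOn (fun s : ℝ => φ (xb + s • u) - s * ⟪gradient φ xb, u⟫ - c * s ^ 2 / 2)
      (Set.Icc 0 t) := by
    refine antitoneOn_of_deriv_nonpos (convex_Icc 0 t)
      (fun s _ => (hder s).continuousAt.continuousWithinAt)
      (fun s _ => (hder s).differentiableAt.differentiableWithinAt) ?_
    intro s hs
    rw [interior_Icc] at hs
    rw [(hder s).deriv]
    have h8 : ⟪u, gradient φ (xb + s • u)⟫ - ⟪u, gradient φ xb⟫ ≤ c * s :=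
      hδs ⟨hs.1, hs.2.trans ht.2⟩
    rw [real_inner_comm (gradient φ (xb + s • u)) u, real_inner_comm (gradient φ xb) u] at h8
    linarith
  have := hanti (Set.left_mem_Icc.2 ht.1.le) (Set.right_mem_Icc.2 ht.1.le) ht.1.le
  simp only [zero_smul, add_zero, zero_mul, sub_zero, ne_eq, OfNat.ofNat_ne_zero, not_false_eq_true,
    zero_pow, mul_zero, zero_div] at this
  linarith

theorem strict_aux {n : ℕ} (φ : En n → ℝ) (hφ : IsC11 φ) (xb : En n) :
    HasStrictFDerivAt φ (InnerProductSpace.toDual ℝ (En n) (gradient φ xb)) xb := by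
  refine hasStrictFDerivAt_of_hasFDerivAt_of_continuousAt
    (f' := fun x => InnerProductSpace.toDual ℝ (En n) (gradient φ x)) ?_ ?_
  · exact Eventually.of_forall fun x => (hφ.1 x).hasGradientAt.hasFDerivAt
  · exact ((InnerProductSpace.toDual ℝ (En n)).continuous.comp hφ.2.continuous).continuousAt

theorem descent_second {n : ℕ} (φ : En n → ℝ) (hφ : IsC11 φ) (xb u v : En n)
    (t : ℕ → ℝ) (vk : ℕ → En n) (ht0 : ∀ k, 0 < t k) (ht : Tendsto t atTop (𝓝 0))
    (hv : Tendsto vk atTop (𝓝 v)) (h1 : ⟪gradient φ xb, u⟫ = 0)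
    (h2 : ⟪gradient φ xb, v⟫ + d2max φ xb u < 0) :
    ∀ᶠ k in atTop, φ (xb + t k • u + ((1 : ℝ) / 2 * (t k) ^ 2) • vk k) < φ xb := by
  obtain ⟨c, hc1, hc2⟩ := exists_between (show d2max φ xb u < -⟪gradient φ xb, v⟫ by linarith)
  have htp : Tendsto t atTop (𝓝[>] 0) :=
    tendsto_nhdsWithin_iff.2 ⟨ht, Eventually.of_forall ht0⟩
  have e1 := htp.eventually (taylor_aux φ hφ xb u c hc1)
  obtain ⟨ε, hε, hεb⟩ : ∃ ε > 0, ⟪gradient φ xb, v⟫ + c + ε * (‖v‖ + 1) < 0 := by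
    have : Tendsto (fun ε : ℝ => ⟪gradient φ xb, v⟫ + c + ε * (‖v‖ + 1)) (𝓝[>] 0)
        (𝓝 (⟪gradient φ xb, v⟫ + c + 0 * (‖v‖ + 1))) :=
      ((by fun_prop : Continuous (fun ε : ℝ => ⟪gradient φ xb, v⟫ + c + ε * (‖v‖ + 1))).tendsto 0).mono_left
        nhdsWithin_le_nhds
    obtain ⟨ε, h⟩ := ((this.eventually_lt_const (by linarith : _ < (0 : ℝ))).and
      self_mem_nhdsWithin).exists
    exact ⟨ε, h.2, h.1⟩
  have hA : Tendsto (fun k => xb + t k • u) atTop (𝓝 xb) := by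
    simpa using tendsto_const_nhds.add (ht.smul_const u)
  have hB : Tendsto (fun k => xb + t k • u + ((1 : ℝ) / 2 * (t k) ^ 2) • vk k) atTop (𝓝 xb) := by
    have := hA.add (((ht.pow 2).const_mul (1 / 2 : ℝ)).smul hv)
    simpa using this
  have e2 := (hB.prodMk_nhds hA).eventually ((strict_aux φ hφ xb).isLittleO.def hε)
  have e3 : ∀ᶠ k in atTop, ⟪gradient φ xb, vk k⟫ + c + ε * ‖vk k‖ < 0 := by
    have : Tendsto (fun k => ⟪gradient φ xb, vk k⟫ + c + ε * ‖vk k‖) atTop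
        (𝓝 (⟪gradient φ xb, v⟫ + c + ε * ‖v‖)) :=
      ((tendsto_const_nhds.inner hv).add_const c).add (hv.norm.const_mul ε)
    exact this.eventually_lt_const (by linarith)
  filter_upwards [e1, e2, e3] with k k1 k2 k3
  have htk := ht0 k
  simp only [add_sub_cancel_left, InnerProductSpace.toDual_apply_apply, real_inner_smul_right,
    norm_smul, Real.norm_eq_abs] at k2
  have hp : 0 < 1 / 2 * t k ^ 2 := by positivity
  rw [abs_of_pos hp] at k2
  have k4 := (abs_le.1 k2).2
  rw [h1] at k1
  have k5 := mul_neg_of_pos_of_neg hp k3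
  linarith

theorem descent_first {n : ℕ} (φ : En n → ℝ) (hφ : IsC11 φ) (xb u v : En n)
    (t : ℕ → ℝ) (vk : ℕ → En n) (ht0 : ∀ k, 0 < t k) (ht : Tendsto t atTop (𝓝 0))
    (hv : Tendsto vk atTop (𝓝 v)) (h1 : ⟪gradient φ xb, u⟫ < 0) :
    ∀ᶠ k in atTop, φ (xb + t k • u + ((1 : ℝ) / 2 * (t k) ^ 2) • vk k) < φ xb := by
  have hd : Tendsto (fun k => u + (1 / 2 * t k) • vk k) atTop (𝓝 u) := by
    have := (tendsto_const_nhds (x := u)).add ((ht.const_mul (1 / 2 : ℝ)).smul hv)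
    simpa using this
  obtain ⟨ε, hε, hεb⟩ : ∃ ε > 0, ⟪gradient φ xb, u⟫ + ε * ‖u‖ < 0 := by
    have : Tendsto (fun ε : ℝ => ⟪gradient φ xb, u⟫ + ε * ‖u‖) (𝓝[>] 0)
        (𝓝 (⟪gradient φ xb, u⟫ + 0 * ‖u‖)) :=
      ((by fun_prop : Continuous (fun ε : ℝ => ⟪gradient φ xb, u⟫ + ε * ‖u‖)).tendsto 0).mono_left
        nhdsWithin_le_nhds
    obtain ⟨ε, h⟩ := ((this.eventually_lt_const (by linarith : _ < (0 : ℝ))).and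
      self_mem_nhdsWithin).exists
    exact ⟨ε, h.2, h.1⟩
  have heq : ∀ k, xb + t k • u + ((1 : ℝ) / 2 * (t k) ^ 2) • vk k
      = xb + t k • (u + (1 / 2 * t k) • vk k) := by
    intro k
    rw [smul_add, smul_smul, add_assoc]
    congr 3
    ring
  have hB : Tendsto (fun k => xb + t k • (u + (1 / 2 * t k) • vk k)) atTop (𝓝 xb) := by
    simpa using tendsto_const_nhds.add (ht.smul hd)
  have e2 := hB.eventually ((strict_aux φ hφ xb).hasFDerivAt.isLittleO.def hε)
  have e3 : ∀ᶠ k in atTop, ⟪gradient φ xb, u + (1 / 2 * t k) • vk k⟫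
      + ε * ‖u + (1 / 2 * t k) • vk k‖ < 0 :=
    ((tendsto_const_nhds.inner hd).add (hd.norm.const_mul ε)).eventually_lt_const hεb
  filter_upwards [e2, e3] with k k2 k3
  have htk := ht0 k
  rw [heq]
  generalize u + (1 / 2 * t k) • vk k = d at *
  simp only [add_sub_cancel_left, InnerProductSpace.toDual_apply_apply, real_inner_smul_right,
    norm_smul, Real.norm_eq_abs, abs_of_pos htk] at k2
  have k4 := (abs_le.1 k2).2
  have k5 := mul_neg_of_pos_of_neg htk k3
  linarith

theorem core_aux {n m p : ℕ} (f : Fin m → En n → ℝ) (g : Fin p → En n → ℝ)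
    (hf : ∀ l, IsC11 (f l)) (xb : En n)
    (hweak : ∃ U ∈ 𝓝 xb, ∀ x ∈ U, (∀ i, g i x ≤ 0) → ¬ (∀ l, f l x < f l xb))
    (u : En n) (hu : IsCriticalDir f g xb u)
    (hA : L2set g xb u ⊆ secondTangent {x | ∀ i, g i x ≤ 0} xb u) :
    ¬ ∃ v : En n, (∀ l, ⟪gradient (f l) xb, u⟫ = 0 → ⟪gradient (f l) xb, v⟫ + d2max (f l) xb u < 0) ∧
      (∀ i, (g i xb = 0 ∧ ⟪gradient (g i) xb, u⟫ = 0) →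
        ⟪gradient (g i) xb, v⟫ + d2max (g i) xb u ≤ 0) := by
  rintro ⟨v, hv1, hv2⟩
  have hvL : v ∈ L2set g xb u := by
    intro i hi
    rcases (hu.2.2 i hi).lt_or_eq with h | h
    · exact Or.inl h
    · exact Or.inr ⟨h, hv2 i ⟨hi, h⟩⟩
  obtain ⟨t, vk, ht0, ht, hvk, hX⟩ := hA hvL
  obtain ⟨U, hU, hUw⟩ := hweak
  have hB : Tendsto (fun k => xb + t k • u + ((1 : ℝ) / 2 * (t k) ^ 2) • vk k) atTop (𝓝 xb) := by
    have := ((tendsto_const_nhds (x := xb)).add (ht.smul_const u)).add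
      (((ht.pow 2).const_mul (1 / 2 : ℝ)).smul hvk)
    simpa using this
  have hall : ∀ᶠ k in atTop, ∀ l, f l (xb + t k • u + ((1 : ℝ) / 2 * (t k) ^ 2) • vk k) < f l xb := by
    rw [eventually_all]
    intro l
    rcases (hu.1 l).lt_or_eq with h | h
    · exact descent_first (f l) (hf l) xb u v t vk ht0 ht hvk h
    · exact descent_second (f l) (hf l) xb u v t vk ht0 ht hvk h (hv1 l h)
  obtain ⟨k, hk1, hk2⟩ := (hall.and (hB.eventually hU)).exists
  exact hUw _ hk2 (hX k) hk1

/-- second-order KKT necessary optimality conditions for a local weak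
efficient solution under the Abadie second-order constraint qualification. -/
theorem stmt9 {n m p : ℕ} (f : Fin m → En n → ℝ) (g : Fin p → En n → ℝ)
    (hf : ∀ l, IsC11 (f l)) (hg : ∀ i, IsC11 (g i))
    (xb : En n) (hxb : ∀ i, g i xb ≤ 0)
    (hweak : ∃ U ∈ 𝓝 xb, ∀ x ∈ U, (∀ i, g i x ≤ 0) → ¬ (∀ l, f l x < f l xb))
    (hASCQ : ∀ u : En n, IsCriticalDir f g xb u →
        L2set g xb u ⊆ secondTangent {x | ∀ i, g i x ≤ 0} xb u)
    (ub : En n) (hub : IsCriticalDir f g xb ub) :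
    ∃ lam : Fin m → ℝ, ∃ mu : Fin p → ℝ,
      (∀ l, 0 ≤ lam l) ∧ lam ≠ 0 ∧ (∀ i, 0 ≤ mu i) ∧
      (∑ l, lam l • gradient (f l) xb) + (∑ i, mu i • gradient (g i) xb) = 0 ∧
      0 ≤ (∑ l, lam l * d2max (f l) xb ub) + (∑ i, mu i * d2max (g i) xb ub) ∧
      (∀ l, ⟪gradient (f l) xb, ub⟫ ≠ 0 → lam l = 0) ∧
      (∀ i, ¬ (g i xb = 0 ∧ ⟪gradient (g i) xb, ub⟫ = 0) → mu i = 0) ∧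
      (∀ w : En n,
        (∀ i, g i xb = 0 → ⟪gradient (g i) xb, ub⟫ = 0 → ⟪gradient (g i) xb, w⟫ ≤ 0) →
        ⟪ub, w⟫ = 0 → 0 ≤ ∑ l, lam l * ⟪gradient (f l) xb, w⟫) := by
  -- it suffices to find multipliers with (i), (ii) supported on active indices
  have fin : ∀ (lam : Fin m → ℝ) (mu : Fin p → ℝ), (∀ l, 0 ≤ lam l) → lam ≠ 0 → (∀ i, 0 ≤ mu i) →
      (∑ l, lam l • gradient (f l) xb) + (∑ i, mu i • gradient (g i) xb) = 0 →
      0 ≤ (∑ l, lam l * d2max (f l) xb ub) + (∑ i, mu i * d2max (g i) xb ub) →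
      (∀ l, ⟪gradient (f l) xb, ub⟫ ≠ 0 → lam l = 0) →
      (∀ i, ¬ (g i xb = 0 ∧ ⟪gradient (g i) xb, ub⟫ = 0) → mu i = 0) →
      ∀ w : En n,
        (∀ i, g i xb = 0 → ⟪gradient (g i) xb, ub⟫ = 0 → ⟪gradient (g i) xb, w⟫ ≤ 0) →
        ⟪ub, w⟫ = 0 → 0 ≤ ∑ l, lam l * ⟪gradient (f l) xb, w⟫ := by
    intro lam mu _ _ hmu h1 _ _ hs w hw _
    have h2 := congrArg (fun z => ⟪z, w⟫) h1
    simp only [inner_add_left, sum_inner, real_inner_smul_left, inner_zero_left] at h2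
    have h3 : ∑ i, mu i * ⟪gradient (g i) xb, w⟫ ≤ 0 := by
      refine Finset.sum_nonpos fun i _ => ?_
      by_cases hi : g i xb = 0 ∧ ⟪gradient (g i) xb, ub⟫ = 0
      · exact mul_nonpos_of_nonneg_of_nonpos (hmu i) (hw i hi.1 hi.2)
      · simp [hs i hi]
    linarith
  suffices H : ∃ lam : Fin m → ℝ, ∃ mu : Fin p → ℝ,
      (∀ l, 0 ≤ lam l) ∧ lam ≠ 0 ∧ (∀ i, 0 ≤ mu i) ∧
      (∑ l, lam l • gradient (f l) xb) + (∑ i, mu i • gradient (g i) xb) = 0 ∧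
      0 ≤ (∑ l, lam l * d2max (f l) xb ub) + (∑ i, mu i * d2max (g i) xb ub) ∧
      (∀ l, ⟪gradient (f l) xb, ub⟫ ≠ 0 → lam l = 0) ∧
      (∀ i, ¬ (g i xb = 0 ∧ ⟪gradient (g i) xb, ub⟫ = 0) → mu i = 0) by
    obtain ⟨lam, mu, a1, a2, a3, a4, a5, a6, a7⟩ := H
    exact ⟨lam, mu, a1, a2, a3, a4, a5, a6, a7, fin lam mu a1 a2 a3 a4 a5 a6 a7⟩
  obtain ⟨lam, mu, c0, hlam, hmu, hc0, hsum, hS, hT, h1, h2⟩ :=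
    alt_aux (fun l => gradient (f l) xb) (fun l => d2max (f l) xb ub)
      (fun i => gradient (g i) xb) (fun i => d2max (g i) xb ub) _ _
      (core_aux f g hf xb hweak ub hub (hASCQ ub hub))
  by_cases hl0 : lam = 0
  swap
  · exact ⟨lam, mu, hlam, hl0, hmu, h1, h2 ▸ hc0, hS, hT⟩
  -- degenerate case: the linearized second-order set is empty; use first-order conditions
  subst hl0
  simp only [Pi.zero_apply, Finset.sum_const_zero, zero_add, zero_smul, zero_mul] at hsum h1 h2
  subst hsum
  have hcrit0 : IsCriticalDir f g xb 0 := by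
    obtain ⟨l, _⟩ := hub.2.1
    exact ⟨by simp, ⟨l, by simp⟩, by simp⟩
  obtain ⟨lam, nu, d0, hlam, hnu, hd0, hsum, -, hT', k1, k2⟩ :=
    alt_aux (fun l => gradient (f l) xb) (fun l => d2max (f l) xb 0)
      (fun i => gradient (g i) xb) (fun i => d2max (g i) xb 0) _ _
      (core_aux f g hf xb hweak 0 hcrit0 (hASCQ 0 hcrit0))
  simp only [d2max_zero, mul_zero, Finset.sum_const_zero, add_zero] at k2
  rw [← k2, add_zero] at hsum
  have hlam0 : lam ≠ 0 := by
    rintro rfl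
    simp at hsum
  have hT0 : ∀ i, g i xb ≠ 0 → nu i = 0 := fun i hi => hT' i (fun h => hi h.1)
  have hin := congrArg (fun z => ⟪z, ub⟫) k1
  simp only [inner_add_left, sum_inner, real_inner_smul_left, inner_zero_left] at hin
  have hA : ∀ l, lam l * ⟪gradient (f l) xb, ub⟫ ≤ 0 := fun l =>
    mul_nonpos_of_nonneg_of_nonpos (hlam l) (hub.1 l)
  have hB : ∀ i, nu i * ⟪gradient (g i) xb, ub⟫ ≤ 0 := by
    intro i
    by_cases hi : g i xb = 0
    · exact mul_nonpos_of_nonneg_of_nonpos (hnu i) (hub.2.2 i hi)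
    · simp [hT0 i hi]
  have hA' := Finset.sum_nonpos (s := Finset.univ) fun l _ => hA l
  have hB' := Finset.sum_nonpos (s := Finset.univ) fun i _ => hB i
  have hA0 : ∀ l, lam l * ⟪gradient (f l) xb, ub⟫ = 0 := fun l =>
    (Finset.sum_eq_zero_iff_of_nonpos (fun l _ => hA l)).1 (by linarith) l (Finset.mem_univ l)
  have hB0 : ∀ i, nu i * ⟪gradient (g i) xb, ub⟫ = 0 := fun i =>
    (Finset.sum_eq_zero_iff_of_nonpos (fun i _ => hB i)).1 (by linarith) i (Finset.mem_univ i)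
  obtain ⟨A, hAdef⟩ : ∃ A : ℝ, A = (∑ l, lam l * d2max (f l) xb ub) + (∑ i, nu i * d2max (g i) xb ub) :=
    ⟨_, rfl⟩
  refine ⟨lam, fun i => nu i + |A| * mu i, hlam, hlam0, fun i => ?_, ?_, ?_, fun l hl => ?_,
    fun i hi => ?_⟩
  · exact add_nonneg (hnu i) (mul_nonneg (abs_nonneg _) (hmu i))
  · simp only [add_smul, Finset.sum_add_distrib, mul_smul, ← Finset.smul_sum]
    rw [h1, smul_zero, add_zero]
    exact k1
  · simp only [add_mul, Finset.sum_add_distrib, mul_assoc, ← Finset.mul_sum]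
    rw [h2, ← add_assoc, ← hAdef]
    linarith [neg_abs_le A]
  · exact (mul_eq_zero.1 (hA0 l)).resolve_right hl
  · have hmi : mu i = 0 := hT i hi
    have hni : nu i = 0 := by
      by_cases hgi : g i xb = 0
      · exact (mul_eq_zero.1 (hB0 i)).resolve_right (fun h => hi ⟨hgi, h⟩)
      · exact hT0 i hgi
    simp [hmi, hni]
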